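/- arXiv:1607.07949 — 2 statements merged into one kernel-verified Lean document; each statement's English description precedes it below -/
import Mathlib

section
/- With the notation of the context (endomorphisms of Λ*(ℝ⁴), real numbers a,b with ab≠0, real parameter h, zeroth-order symbol p₀, and unit vector ξ' in the span of {e₁,e₂,e₃}), one has tr[c̃(ξ')∘p₀∘c̃(ξ')∘ε(e₄)] = 6ab²h. -/
open scoped BigOperators

noncomputable section

/-- The standard orthonormal basis vectors of `ℝ⁴`; `stdBasis 3` is `e₄`. -/
def stdBasis (i : Fin 4) : EuclideanSpace ℝ (Fin 4) := EuclideanSpace.single i 1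

/-- Left exterior multiplication `ε(v)` on the exterior algebra `Λ*(ℝ⁴)`. -/
def eps (v : EuclideanSpace ℝ (Fin 4)) :
    ExteriorAlgebra ℝ (EuclideanSpace ℝ (Fin 4)) →ₗ[ℝ]
      ExteriorAlgebra ℝ (EuclideanSpace ℝ (Fin 4)) :=
  LinearMap.mulLeft ℝ (ExteriorAlgebra.ι ℝ v)

/-- Interior multiplication (contraction) `ι(v)` with respect to the inner product. -/
def iot (v : EuclideanSpace ℝ (Fin 4)) :
    ExteriorAlgebra ℝ (EuclideanSpace ℝ (Fin 4)) →ₗ[ℝ]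
      ExteriorAlgebra ℝ (EuclideanSpace ℝ (Fin 4)) :=
  CliffordAlgebra.contractLeft ((innerSL ℝ v).toLinearMap)

/-- `c(v) = ε(v) - ι(v)`. -/
def cOp (v : EuclideanSpace ℝ (Fin 4)) := eps v - iot v

/-- `ĉ(v) = ε(v) + ι(v)`. -/
def cHat (v : EuclideanSpace ℝ (Fin 4)) := eps v + iot v

/-- `c̃(v) = a·ε(v) - b·ι(v)`. -/
def cTil (a b : ℝ) (v : EuclideanSpace ℝ (Fin 4)) := a • eps v - b • iot v

/-- The zeroth-order symbol
`p₀ = -(h/4)·Σᵢ c̃(eᵢ)∘ĉ(eᵢ)∘ĉ(e₄) + (h/4)·Σᵢ c̃(eᵢ)∘c(eᵢ)∘c(e₄)`. -/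
def p0 (a b h : ℝ) :
    ExteriorAlgebra ℝ (EuclideanSpace ℝ (Fin 4)) →ₗ[ℝ]
      ExteriorAlgebra ℝ (EuclideanSpace ℝ (Fin 4)) :=
  (-(h / 4)) • ∑ i : Fin 3,
      (cTil a b (stdBasis i.castSucc) ∘ₗ cHat (stdBasis i.castSucc) ∘ₗ cHat (stdBasis 3))
    + (h / 4) • ∑ i : Fin 3,
      (cTil a b (stdBasis i.castSucc) ∘ₗ cOp (stdBasis i.castSucc) ∘ₗ cOp (stdBasis 3))

abbrev EA := ExteriorAlgebra ℝ (EuclideanSpace ℝ (Fin 4))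

lemma end_mul_neg (A B : Module.End ℝ EA) : A * -B = -(A * B) := by
  apply LinearMap.ext
  intro x
  exact map_neg A (B x)

lemma end_neg_mul (A B : Module.End ℝ EA) : -A * B = -(A * B) := rfl

lemma eps_anti (u v : EuclideanSpace ℝ (Fin 4)) :
    (eps u * eps v : Module.End ℝ EA) = -(eps v * eps u) := by
  apply LinearMap.ext
  intro x
  have h := ExteriorAlgebra.ι_add_mul_swap (R := ℝ) u v
  have h2 : ExteriorAlgebra.ι ℝ u * ExteriorAlgebra.ι ℝ v
    = - (ExteriorAlgebra.ι ℝ v * ExteriorAlgebra.ι ℝ u) := eq_neg_of_add_eq_zero_left h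
  simp only [eps, Module.End.mul_apply, LinearMap.neg_apply, LinearMap.mulLeft_apply]
  rw [← mul_assoc, h2, neg_mul, mul_assoc]

lemma eps_sq (u : EuclideanSpace ℝ (Fin 4)) :
    (eps u * eps u : Module.End ℝ EA) = 0 := by
  apply LinearMap.ext
  intro x
  simp only [eps, Module.End.mul_apply, LinearMap.zero_apply, LinearMap.mulLeft_apply]
  rw [← mul_assoc, ExteriorAlgebra.ι_sq_zero, zero_mul]

lemma iot_anti (u v : EuclideanSpace ℝ (Fin 4)) :
    (iot u * iot v : Module.End ℝ EA) = -(iot v * iot u) := by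
  apply LinearMap.ext
  intro x
  exact CliffordAlgebra.contractLeft_comm _ _ x

lemma iot_sq (u : EuclideanSpace ℝ (Fin 4)) :
    (iot u * iot u : Module.End ℝ EA) = 0 := by
  apply LinearMap.ext
  intro x
  exact CliffordAlgebra.contractLeft_contractLeft _ x

lemma iot_eps (u v : EuclideanSpace ℝ (Fin 4)) :
    (iot u * eps v : Module.End ℝ EA) = (inner ℝ u v : ℝ) • (1 : Module.End ℝ EA) - eps v * iot u := by
  apply LinearMap.ext
  intro x
  exact CliffordAlgebra.contractLeft_ι_mul _ v x

lemma basis_inner (i j : Fin 4) : (inner ℝ (stdBasis i) (stdBasis j) : ℝ) = if i = j then 1 else 0 := by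
  simp [stdBasis, EuclideanSpace.inner_single_left, Pi.single_apply, EuclideanSpace.single]

lemma trace_id_EA : LinearMap.trace ℝ EA 1 = 16 := by
  have B := (EuclideanSpace.basisFun (Fin 4) ℝ).toBasis.ExteriorAlgebra
  have := Module.Free.of_basis B
  have := Module.Finite.of_basis B
  rw [LinearMap.trace_one, Module.finrank_eq_card_basis B]
  simp

/-- `tr(ι ε Y) = tr(Y)/2` for a unit vector and `Y` commuting with `ι`. -/
lemma trace_half (u : EuclideanSpace ℝ (Fin 4)) (hu : (inner ℝ u u : ℝ) = 1)
    (Y : Module.End ℝ EA) (hY : Y * iot u = iot u * Y) :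
    LinearMap.trace ℝ EA (iot u * eps u * Y) = LinearMap.trace ℝ EA Y / 2 := by
  have h1 : LinearMap.trace ℝ EA (iot u * eps u * Y) = LinearMap.trace ℝ EA (eps u * iot u * Y) := by
    rw [mul_assoc, LinearMap.trace_mul_comm, mul_assoc, hY, mul_assoc]
  have h2 : iot u * eps u * Y = Y - eps u * iot u * Y := by
    rw [iot_eps, hu, one_smul, sub_mul, one_mul]
  have h3 := congrArg (LinearMap.trace ℝ EA) h2
  rw [map_sub, ← h1] at h3
  linarith

lemma trace_four (u v : EuclideanSpace ℝ (Fin 4)) (hu : (inner ℝ u u : ℝ) = 1)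
    (hv : (inner ℝ v v : ℝ) = 1) (huv : (inner ℝ u v : ℝ) = 0) :
    LinearMap.trace ℝ EA (iot u * eps u * (iot v * eps v)) = 4 := by
  rw [trace_half u hu]
  · have := trace_half v hv 1 (by simp)
    rw [mul_one] at this
    rw [this, trace_id_EA]; norm_num
  · have h : eps v * iot u = -(iot u * eps v) := by rw [iot_eps, huv]; simp
    rw [mul_assoc, h, end_mul_neg, ← mul_assoc, iot_anti v u, end_neg_mul, neg_neg, mul_assoc]

lemma cTil_sq (a b : ℝ) (u : EuclideanSpace ℝ (Fin 4)) (hu : (inner ℝ u u : ℝ) = 1) :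
    (cTil a b u * cTil a b u : Module.End ℝ EA) = (-(a * b)) • (1 : Module.End ℝ EA) := by
  simp only [cTil, sub_mul, mul_sub, smul_mul_assoc, mul_smul_comm, eps_sq, iot_sq, iot_eps, hu]
  module

lemma cTil_eps (a b : ℝ) (u v : EuclideanSpace ℝ (Fin 4)) (huv : (inner ℝ u v : ℝ) = 0) :
    (cTil a b u * eps v : Module.End ℝ EA) = -(eps v * cTil a b u) := by
  simp only [cTil, sub_mul, mul_sub, smul_mul_assoc, mul_smul_comm, eps_anti u v, iot_eps, huv]
  module

lemma p0_eq (a b h : ℝ) : p0 a b h = (h / 2) • ∑ i : Fin 3,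
    (b • ((iot (stdBasis i.castSucc) * eps (stdBasis i.castSucc)) * iot (stdBasis 3))
      - a • ((eps (stdBasis i.castSucc) * iot (stdBasis i.castSucc)) * eps (stdBasis 3))
      : Module.End ℝ EA) := by
  rw [p0, Finset.smul_sum, Finset.smul_sum, Finset.smul_sum, ← Finset.sum_add_distrib]
  refine Finset.sum_congr rfl fun i _ => ?_
  generalize stdBasis i.castSucc = u
  generalize stdBasis 3 = v
  change (-(h / 4)) • (cTil a b u * (cHat u * cHat v) : Module.End ℝ EA)
    + (h / 4) • (cTil a b u * (cOp u * cOp v) : Module.End ℝ EA) = _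
  have e1 : ∀ Z : Module.End ℝ EA, eps u * (eps u * Z) = 0 := fun Z => by
    rw [← mul_assoc, eps_sq, zero_mul]
  have e2 : ∀ Z : Module.End ℝ EA, iot u * (iot u * Z) = 0 := fun Z => by
    rw [← mul_assoc, iot_sq, zero_mul]
  simp only [cTil, cHat, cOp, sub_mul, mul_sub, add_mul, mul_add, smul_mul_assoc, mul_smul_comm,
    mul_assoc, e1, e2]
  module

lemma trace_term (a b : ℝ) (X N J F : Module.End ℝ EA) (hX : X * X = (-(a * b)) • 1)
    (hF : X * F = -(F * X)) :
    LinearMap.trace ℝ EA (X * (N * J * (X * F))) = a * b * LinearMap.trace ℝ EA (N * (J * F)) := by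
  have h : X * (N * J * (X * F)) = -(X * (N * (J * F)) * X) := by
    rw [hF]; simp only [end_mul_neg, mul_assoc]
  rw [h, map_neg, LinearMap.trace_mul_comm, ← mul_assoc, hX, smul_mul_assoc, one_mul, map_smul,
    smul_eq_mul]
  ring

theorem trace_cTil_xi_p0_cTil_xi_eps_e4 (a b h : ℝ) (hab : a * b ≠ 0)
    (ξ' : EuclideanSpace ℝ (Fin 4))
    (hspan : ξ' ∈ Submodule.span ℝ {stdBasis 0, stdBasis 1, stdBasis 2})
    (hξ : ‖ξ'‖ = 1) :
    LinearMap.trace ℝ _ (cTil a b ξ' ∘ₗ p0 a b h ∘ₗ cTil a b ξ' ∘ₗ eps (stdBasis 3)) = 6 * a * b ^ 2 * h := by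
  have hin : (inner ℝ ξ' (stdBasis 3) : ℝ) = 0 := by
    clear hξ
    induction hspan using Submodule.span_induction with
    | mem x hx =>
      rcases hx with rfl | rfl | rfl <;> rw [basis_inner] <;> simp
    | zero => simp
    | add x y _ _ hx hy => rw [inner_add_left, hx, hy, add_zero]
    | smul c x _ hx => rw [real_inner_smul_left, hx, mul_zero]
  have hn : (inner ℝ ξ' ξ' : ℝ) = 1 := by
    rw [real_inner_self_eq_norm_sq, hξ]; norm_num
  have hX := cTil_sq a b ξ' hn
  have hF := cTil_eps a b ξ' (stdBasis 3) hin
  change LinearMap.trace ℝ EA (cTil a b ξ' * (p0 a b h * (cTil a b ξ' * eps (stdBasis 3)))) = _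
  rw [p0_eq]
  have key : ∀ i : Fin 3, LinearMap.trace ℝ EA (iot (stdBasis i.castSucc) * eps (stdBasis i.castSucc)
      * (iot (stdBasis 3) * eps (stdBasis 3))) = 4 := by
    intro i
    apply trace_four
    · rw [basis_inner]; simp
    · rw [basis_inner]; simp
    · rw [basis_inner]; fin_cases i <;> simp
  simp only [smul_mul_assoc, mul_smul_comm, Finset.sum_mul, Finset.mul_sum, sub_mul, mul_sub,
    map_smul, map_sum, map_sub, smul_eq_mul, trace_term a b _ _ _ _ hX hF, eps_sq, mul_zero,
    map_zero, key]
  simp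
  ring
end
end

section
/- The improper integral over the real line of the complex-valued function ξ ↦ 8(−1 − 2iξ + 3ξ² + 2iξ³)/((ξ−i)²·(1+ξ²)³) equals 2π, i.e. ∫_{−∞}^{+∞} 8(−1−2iξ+3ξ²+2iξ³)/((ξ−i)²(1+ξ²)³) dξ = 2π. -/
open Complex MeasureTheory

noncomputable section

lemma aux_sub_ne (x : ℝ) : (x : ℂ) - I ≠ 0 := by
  intro h
  have := congrArg Complex.im h
  simp at this

lemma aux_add_ne (x : ℝ) : (x : ℂ) + I ≠ 0 := by
  intro h
  have := congrArg Complex.im h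
  simp at this

lemma aux_one_add (x : ℂ) : 1 + x ^ 2 = (x - I) * (x + I) := by
  linear_combination I_sq

lemma aux_deriv (x : ℝ) : HasDerivAt (fun t : ℝ => 2 * ((Real.arctan t : ℝ) : ℂ)
      + I * (((t : ℂ) + I)⁻¹) ^ 2 + 3 / 2 * ((t : ℂ) + I)⁻¹
      - 2 / 3 * (((t : ℂ) - I)⁻¹) ^ 3 + 1 / 2 * ((t : ℂ) - I)⁻¹)
    ((8 * (-1 - 2 * I * (x : ℂ) + 3 * ((x : ℂ)) ^ 2 + 2 * I * ((x : ℂ)) ^ 3)) /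
      ((((x : ℂ)) - I) ^ 2 * (1 + ((x : ℂ)) ^ 2) ^ 3)) x := by
  have h1 := aux_sub_ne x
  have h2 := aux_add_ne x
  have hx : HasDerivAt (fun t : ℝ => (t : ℂ)) 1 x := Complex.ofRealCLM.hasDerivAt
  have ha := (Real.hasDerivAt_arctan x).ofReal_comp.const_mul (2 : ℂ)
  have hp := (hx.add_const I).fun_inv h2
  have hm := (hx.sub_const I).fun_inv h1
  have H := (((ha.add ((hp.fun_pow 2).const_mul I)).add (hp.const_mul (3 / 2))).sub
    ((hm.fun_pow 3).const_mul (2 / 3))).add (hm.const_mul (1 / 2))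
  refine H.congr_deriv ?_
  push_cast
  rw [aux_one_add]
  have h3 : I ^ 2 = -1 := I_sq
  field_simp
  generalize (x : ℂ) = z
  have e3 : I ^ 3 = -I := by linear_combination I * h3
  have e4 : I ^ 4 = 1 := by linear_combination (I ^ 2 - 1) * h3
  have e5 : I ^ 5 = I := by linear_combination I * e4
  have e6 : I ^ 6 = -1 := by linear_combination I ^ 2 * e4 + h3
  have e7 : I ^ 7 = -I := by linear_combination I ^ 3 * e4 + e3
  have e8 : I ^ 8 = 1 := by linear_combination (I ^ 4 + 1) * e4
  ring_nf
  simp only [h3, e3, e4, e5, e6, e7, e8]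
  ring

lemma aux_int : Integrable (fun ξ : ℝ =>
    (8 * (-1 - 2 * I * (ξ : ℂ) + 3 * ((ξ : ℂ)) ^ 2 + 2 * I * ((ξ : ℂ)) ^ 3)) /
      ((((ξ : ℂ)) - I) ^ 2 * (1 + ((ξ : ℂ)) ^ 2) ^ 3)) := by
  refine (integrable_inv_one_add_sq.const_mul 64).mono' ?_ ?_
  · refine Continuous.aestronglyMeasurable ?_
    refine Continuous.div (by fun_prop) (by fun_prop) ?_
    intro x
    rw [aux_one_add]
    have h1 := aux_sub_ne x
    have h2 := aux_add_ne x
    positivity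
  · refine Filter.Eventually.of_forall fun x => ?_
    have hs : ‖(x : ℂ) - I‖ ^ 2 = 1 + x ^ 2 := by
      rw [← Complex.normSq_eq_norm_sq, Complex.normSq_apply]; simp; ring
    have hq : ‖1 + (x : ℂ) ^ 2‖ = 1 + x ^ 2 := by
      have : 1 + (x : ℂ) ^ 2 = ((1 + x ^ 2 : ℝ) : ℂ) := by push_cast; rfl
      rw [this, Complex.norm_real, Real.norm_of_nonneg (by positivity)]
    have hN : ‖-1 - 2 * I * (x : ℂ) + 3 * ((x : ℂ)) ^ 2 + 2 * I * ((x : ℂ)) ^ 3‖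
        ≤ 1 + 2 * |x| + 3 * |x| ^ 2 + 2 * |x| ^ 3 := by
      refine (norm_add_le _ _).trans (add_le_add ((norm_add_le _ _).trans
        (add_le_add ((norm_sub_le _ _).trans ?_) ?_)) ?_) <;> simp
    rw [norm_div, norm_mul, norm_mul, norm_pow, norm_pow, hs, hq, div_le_iff₀ (by positivity)]
    have h8 : ‖(8 : ℂ)‖ = 8 := by simp
    rw [h8]
    have e : 64 * (1 + x ^ 2)⁻¹ * ((1 + x ^ 2) * (1 + x ^ 2) ^ 3) = 64 * (1 + |x| ^ 2) ^ 3 := by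
      rw [sq_abs]
      have : 1 + x ^ 2 ≠ 0 := by positivity
      field_simp
    rw [e]
    have ht := abs_nonneg x
    generalize |x| = t at *
    have b1 : 2 * t ≤ 1 + t ^ 2 := by nlinarith [sq_nonneg (t - 1)]
    have b3 : 2 * t ^ 3 ≤ (1 + t ^ 2) * t ^ 2 := by nlinarith [mul_le_mul_of_nonneg_right b1 (sq_nonneg t)]
    nlinarith [sq_nonneg t, sq_nonneg (t ^ 2), mul_nonneg (sq_nonneg t) (sq_nonneg (t ^ 2))]

lemma aux_tendsto (l : Filter ℝ) (hl : Filter.Tendsto (fun t : ℝ => |t|) l Filter.atTop)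
    (c : ℝ) (hc : Filter.Tendsto Real.arctan l (nhds c)) :
    Filter.Tendsto (fun t : ℝ => 2 * ((Real.arctan t : ℝ) : ℂ)
      + I * (((t : ℂ) + I)⁻¹) ^ 2 + 3 / 2 * ((t : ℂ) + I)⁻¹
      - 2 / 3 * (((t : ℂ) - I)⁻¹) ^ 3 + 1 / 2 * ((t : ℂ) - I)⁻¹) l (nhds (2 * (c : ℂ))) := by
  have hp : Filter.Tendsto (fun t : ℝ => ((t : ℂ) + I)⁻¹) l (nhds 0) := by
    refine Filter.tendsto_inv₀_cobounded.comp (tendsto_norm_atTop_iff_cobounded.1 ?_)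
    refine Filter.tendsto_atTop_mono (fun t => ?_) hl
    simpa using Complex.abs_re_le_norm ((t : ℂ) + I)
  have hm : Filter.Tendsto (fun t : ℝ => ((t : ℂ) - I)⁻¹) l (nhds 0) := by
    refine Filter.tendsto_inv₀_cobounded.comp (tendsto_norm_atTop_iff_cobounded.1 ?_)
    refine Filter.tendsto_atTop_mono (fun t => ?_) hl
    simpa using Complex.abs_re_le_norm ((t : ℂ) - I)
  have ha := ((Complex.continuous_ofReal.tendsto c).comp hc).const_mul (2 : ℂ)
  have H := (((ha.add ((hp.pow 2).const_mul I)).add (hp.const_mul (3 / 2))).sub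
    ((hm.pow 3).const_mul (2 / 3))).add (hm.const_mul (1 / 2))
  simpa using H

theorem integral_case_aII_second :
    ∫ ξ : ℝ, (8 * (-1 - 2 * I * (ξ : ℂ) + 3 * ((ξ : ℂ)) ^ 2 + 2 * I * ((ξ : ℂ)) ^ 3)) /
      ((((ξ : ℂ)) - I) ^ 2 * (1 + ((ξ : ℂ)) ^ 2) ^ 3) = 2 * (Real.pi : ℂ) := by
  rw [integral_of_hasDerivAt_of_tendsto aux_deriv aux_int
    (aux_tendsto _ Filter.tendsto_abs_atBot_atTop _
      (Real.tendsto_arctan_atBot.mono_right nhdsWithin_le_nhds))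
    (aux_tendsto _ Filter.tendsto_abs_atTop_atTop _
      (Real.tendsto_arctan_atTop.mono_right nhdsWithin_le_nhds))]
  push_cast
  ring
end
end
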